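/- arXiv:1412.6084 — 7 statements merged into one kernel-verified Lean document; each statement's English description precedes it below -/
import Mathlib

section
/- Let n be a natural number, Δ a finite nonempty index set, and for each D ∈ Δ let u_D ∈ ℝ^n be a vector and m_D > 0 a real number. Let V ⊆ ℝ^n be a finite set, let b : V → ℝ satisfy b_v ≥ 0 for all v ∈ V and Σ_{v∈V} b_v = 1, and set ϑ := Σ_{v∈V} b_v · v. Let ε > 0 be a real number such that m_D·(1 + ⟨u_D, v⟩) ≥ ε for every D ∈ Δ and v ∈ V with ⟨u_D, v⟩ ≠ −1, where ⟨·,·⟩ is the standard inner product on ℝ^n. Assume moreover that for every v ∈ V the set {D ∈ Δ : ⟨u_D, v⟩ = −1} has exactly n elements. Then ε·(|Δ| − n) ≤ Σ_{D∈Δ} (m_D + m_D·⟨u_D, ϑ⟩). -/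
/-- If every nonzero value of `f` is at least `ε`, then `∑ i, f i` is at least `ε` times the number
of indices where `f` does not vanish. -/
theorem mul_card_sub_ncard_le_sum {ι : Type*} [Fintype ι] (f : ι → ℝ) (ε : ℝ)
    (hf : ∀ i, f i ≠ 0 → ε ≤ f i) :
    ε * ((Fintype.card ι : ℝ) - ({i | f i = 0}.ncard : ℝ)) ≤ ∑ i, f i := by
  classical
  have hcard : (Fintype.card ι : ℝ) - ({i | f i = 0}.ncard : ℝ) =
      (Finset.univ.filter fun i => f i ≠ 0).card := by
    have h := Finset.card_filter_add_card_filter_not (s := Finset.univ) (fun i => f i = 0)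
    rw [Set.ncard_eq_toFinset_card', Set.toFinset_ofPred, ← Finset.card_univ, ← h]
    push_cast
    ring
  rw [hcard, ← Finset.sum_filter_ne_zero, mul_comm, ← nsmul_eq_mul]
  exact Finset.card_nsmul_le_sum _ _ _ fun i hi => hf i (Finset.mem_filter.mp hi).2


/-- the key inequality of Proposition 4.3. Here `ι` plays the role of the
finite nonempty index set `Δ`, `u D` of the vectors `u_D ∈ ℝ^n`, `m D > 0` of the
coefficients, `V` is a finite set of vectors, `b` a system of convex-combination
coefficients with barycenter `ϑ`, and `ε > 0` satisfies `m_D (1 + ⟨u_D, v⟩) ≥ ε` whenever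
`⟨u_D, v⟩ ≠ −1`.  Assuming each `v ∈ V` satisfies `⟨u_D, v⟩ = −1` for exactly `n` indices
`D`, we get `ε (|Δ| − n) ≤ Σ_D (m_D + m_D ⟨u_D, ϑ⟩)`. -/
theorem eps_mul_card_sub_rank_le {ι : Type*} [Fintype ι] [Nonempty ι] (n : ℕ)
    (u : ι → Fin n → ℝ) (m : ι → ℝ) (hm : ∀ D, 0 < m D)
    (V : Finset (Fin n → ℝ)) (b : (Fin n → ℝ) → ℝ)
    (hb : ∀ v ∈ V, 0 ≤ b v) (hb1 : ∑ v ∈ V, b v = 1)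
    (ϑ : Fin n → ℝ) (hϑ : ϑ = ∑ v ∈ V, b v • v)
    (ε : ℝ) (hε : 0 < ε)
    (hεle : ∀ D, ∀ v ∈ V, (∑ j, u D j * v j) ≠ -1 → ε ≤ m D * (1 + ∑ j, u D j * v j))
    (hcard : ∀ v ∈ V, {D : ι | ∑ j, u D j * v j = -1}.ncard = n) :
    ε * ((Fintype.card ι : ℝ) - (n : ℝ)) ≤ ∑ D, (m D + m D * ∑ j, u D j * ϑ j) := by
  have hvertex : ∀ v ∈ V, ε * ((Fintype.card ι : ℝ) - n) ≤ ∑ D, m D * (1 + u D ⬝ᵥ v) := by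
    intro v hv
    have hzero : ∀ D, m D * (1 + u D ⬝ᵥ v) = 0 ↔ u D ⬝ᵥ v = -1 := fun D => by
      rw [mul_eq_zero_iff_left (hm D).ne', add_comm, add_eq_zero_iff_eq_neg]
    have h := mul_card_sub_ncard_le_sum (fun D => m D * (1 + u D ⬝ᵥ v)) ε
      fun D hD => hεle D v hv (mt (hzero D).mpr hD)
    simp only [hzero] at h
    rwa [show {D | u D ⬝ᵥ v = -1}.ncard = n from hcard v hv] at h
  calc ε * ((Fintype.card ι : ℝ) - n)
      = ∑ v ∈ V, b v * (ε * ((Fintype.card ι : ℝ) - n)) := by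
        rw [← Finset.sum_mul, hb1, one_mul]
    _ ≤ ∑ v ∈ V, b v * ∑ D, m D * (1 + u D ⬝ᵥ v) :=
        Finset.sum_le_sum fun v hv => mul_le_mul_of_nonneg_left (hvertex v hv) (hb v hv)
    _ = ∑ D, m D * ∑ v ∈ V, b v * (1 + u D ⬝ᵥ v) := by
        simp only [Finset.mul_sum]
        rw [Finset.sum_comm]
        simp only [mul_left_comm]
    _ = ∑ D, (m D + m D * u D ⬝ᵥ ϑ) := by
        refine Finset.sum_congr rfl fun D _ => ?_
        simp only [hϑ, dotProduct_sum, dotProduct_smul, smul_eq_mul, mul_add, mul_one,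
          Finset.sum_add_distrib, hb1]
end

section
/- Let Σ be a finite index set and V = ℝ^Σ with standard basis (e_γ)_{γ∈Σ}; for x ∈ V write x ≥ 0 if all coordinates x_γ are nonnegative. Let Γ be a finite set equipped with linear functionals ρ_D : V → ℝ (D ∈ Γ) such that for every D ∈ Γ and every γ ∈ Σ the value ρ_D(e_γ) is a nonpositive integer. Define n_γ := −Σ_{D∈Γ} ρ_D(e_γ) and S := {γ ∈ Σ : n_γ > 0}. Then for every x ∈ V with x ≥ 0 and ρ_D(x) ≥ −1 for all D ∈ Γ, the following hold: (i) x_γ ≤ 1 for every γ ∈ S; (ii) Σ_{D∈Γ} ρ_D(x) ≤ −Σ_{γ∈S} x_γ. -/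
open scoped Classical

/-- the combinatorial core of Proposition 5.8. With `V = ℝ^Σ`,
standard basis vectors `Pi.single γ 1`, linear functionals `ρ D` taking nonpositive
integer values on the basis, `n_γ := −Σ_D ρ_D(e_γ)` and `S := {γ : n_γ > 0}`, every
`x ≥ 0` with `ρ_D(x) ≥ −1` for all `D` satisfies `x_γ ≤ 1` for `γ ∈ S` and
`Σ_D ρ_D(x) ≤ −Σ_{γ∈S} x_γ`. -/
theorem skeleton_elementary_reduction {σ ι : Type*} [Fintype σ] [Fintype ι]
    (ρ : ι → ((σ → ℝ) →ₗ[ℝ] ℝ))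
    (hint : ∀ (D : ι) (γ : σ), ∃ z : ℤ, z ≤ 0 ∧ ρ D (Pi.single γ 1) = (z : ℝ))
    (nγ : σ → ℝ) (hn : ∀ γ, nγ γ = -∑ D, ρ D (Pi.single γ 1))
    (S : Set σ) (hS : S = {γ | 0 < nγ γ})
    (x : σ → ℝ) (hx0 : ∀ γ, 0 ≤ x γ) (hxρ : ∀ D, -1 ≤ ρ D x) :
    (∀ γ ∈ S, x γ ≤ 1) ∧
      ∑ D, ρ D x ≤ -∑ γ ∈ Finset.univ.filter (fun γ => γ ∈ S), x γ := by
  have hexp : ∀ D, ρ D x = ∑ γ, x γ * ρ D (Pi.single γ 1) := fun D => by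
    conv_lhs => rw [← Finset.univ_sum_single x, map_sum]
    refine Finset.sum_congr rfl fun γ _ => ?_
    rw [← smul_eq_mul, ← map_smul, ← Pi.single_smul, smul_eq_mul, mul_one]
  have hnonpos : ∀ D γ, ρ D (Pi.single γ 1) ≤ 0 := fun D γ => by
    obtain ⟨z, hz, h⟩ := hint D γ
    rw [h]
    exact_mod_cast hz
  have hle : ∀ γ ∈ S, ∃ D, ρ D (Pi.single γ 1) ≤ -1 := fun γ hγ => by
    rw [hS, Set.mem_ofPred_eq, hn, neg_pos] at hγ
    obtain ⟨D, -, hD⟩ := Finset.exists_lt_of_sum_lt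
      (show ∑ D, ρ D (Pi.single γ 1) < ∑ _D : ι, (0 : ℝ) by simpa using hγ)
    obtain ⟨z, -, h⟩ := hint D γ
    refine ⟨D, ?_⟩
    rw [h] at hD ⊢
    have hz : z < 0 := by exact_mod_cast hD
    exact_mod_cast (show z ≤ -1 by omega)
  constructor
  · intro γ hγ
    obtain ⟨D, hD⟩ := hle γ hγ
    have hterm : ρ D x ≤ x γ * ρ D (Pi.single γ 1) := by
      rw [hexp D, ← Finset.add_sum_erase _ _ (Finset.mem_univ γ)]
      exact add_le_of_nonpos_right (Finset.sum_nonpos fun δ _ =>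
        mul_nonpos_of_nonneg_of_nonpos (hx0 δ) (hnonpos D δ))
    nlinarith [hxρ D, hx0 γ]
  · simp_rw [hexp]
    rw [Finset.sum_comm, Finset.sum_filter, ← Finset.sum_neg_distrib]
    refine Finset.sum_le_sum fun γ _ => ?_
    rw [← Finset.mul_sum]
    split_ifs with hγ
    · obtain ⟨D, hD⟩ := hle γ hγ
      have hsum : ∑ D, ρ D (Pi.single γ 1) ≤ -1 := by
        rw [← Finset.add_sum_erase _ _ (Finset.mem_univ D)]
        linarith [Finset.sum_nonpos fun E (_ : E ∈ Finset.univ.erase D) => hnonpos E γ]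
      nlinarith [hx0 γ]
    · rw [neg_zero]
      exact mul_nonpos_of_nonneg_of_nonpos (hx0 γ)
        (Finset.sum_nonpos fun D _ => hnonpos D γ)
end

section
/- Fix integers n ≥ 2 and k with 1 ≤ k and 2k ≤ n + 1. Suppose the real numbers y_1, …, y_n, z are dual-feasible, i.e. (with the conventions y_0 = 0 and y_{n+1} = 0): y_j ≥ 0 for all 1 ≤ j ≤ n, z ≥ 0, and for every j with 1 ≤ j ≤ n one has (1/2)y_{j−1} − y_j + (1/2)y_{j+1} + [j = k]·z ≥ [j = 1] − [j = k] + [j = n], where [P] denotes 1 if P holds and 0 otherwise. Then: (i) y_i ≥ 2(i−1) + i·y_1 for all 1 ≤ i ≤ k; (ii) y_i ≥ 2(n−i) + (n−i+1)·y_n for all k ≤ i ≤ n; (iii) z ≥ y_k − (1/2)(y_{k−1} + y_{k+1}) − 1. -/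
/-- A sequence starting at `0` that is convex up to index `m`, with second difference at least
`2` at index `1`, grows at least linearly with slope `a 1 + 2` from index `1` on. -/
lemma linear_lower_bound_of_second_difference (a : ℕ → ℝ) (m : ℕ) (h0 : a 0 = 0)
    (h : ∀ j, 1 ≤ j → j < m →
      (if j = 1 then (2 : ℝ) else 0) ≤ a (j - 1) - 2 * a j + a (j + 1)) :
    ∀ i, 1 ≤ i → i ≤ m → 2 * ((i : ℝ) - 1) + (i : ℝ) * a 1 ≤ a i := by
  have slope : ∀ i, 1 ≤ i → i < m → a 1 + 2 ≤ a (i + 1) - a i := by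
    intro i hi
    induction i, hi using Nat.le_induction with
    | base =>
      intro hm
      have := h 1 le_rfl hm
      norm_num [h0] at this ⊢
      linarith
    | succ i hi ih =>
      intro hm
      have h1 := ih (by omega)
      have h2 := h (i + 1) (by omega) hm
      rw [if_neg (by omega), Nat.add_sub_cancel] at h2
      linarith
  intro i hi
  induction i, hi using Nat.le_induction with
  | base => intro _; simp
  | succ i hi ih =>
    intro hm
    have h1 := ih (by omega)
    have h2 := slope i hi hm
    push_cast
    linarith


/-- Proposition 7.1. For the dual linear program of the symmetric spherical
skeleton of `PSL(n+1) ⊆ PSL(n+1) × PSL(n+1)` with marked root `γ_k`, every dual-feasible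
point `(y, z)` (with conventions `y 0 = 0`, `y (n+1) = 0`) satisfies the three families of
lower bounds (i), (ii), (iii). -/
theorem dual_feasible_lower_bounds (n k : ℕ) (hn : 2 ≤ n) (hk1 : 1 ≤ k)
    (hk2 : 2 * k ≤ n + 1)
    (y : ℕ → ℝ) (z : ℝ) (hy0 : y 0 = 0) (hyn1 : y (n + 1) = 0)
    (hynn : ∀ j, 1 ≤ j → j ≤ n → 0 ≤ y j) (hz : 0 ≤ z)
    (hfeas : ∀ j, 1 ≤ j → j ≤ n →
      (if j = 1 then (1 : ℝ) else 0) - (if j = k then 1 else 0)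
          + (if j = n then 1 else 0) ≤
        (1 / 2) * y (j - 1) - y j + (1 / 2) * y (j + 1) + (if j = k then z else 0)) :
    (∀ i, 1 ≤ i → i ≤ k → 2 * ((i : ℝ) - 1) + (i : ℝ) * y 1 ≤ y i) ∧
    (∀ i, k ≤ i → i ≤ n →
        2 * ((n : ℝ) - (i : ℝ)) + ((n : ℝ) - (i : ℝ) + 1) * y n ≤ y i) ∧
    (y k - (1 / 2) * (y (k - 1) + y (k + 1)) - 1 ≤ z) := by
  have hkn : k < n := by omega
  refine ⟨?_, ?_, ?_⟩
  · refine linear_lower_bound_of_second_difference y k hy0 fun j hj hjk => ?_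
    have h := hfeas j hj (by omega)
    rw [if_neg (show j ≠ k by omega), if_neg (show j ≠ n by omega),
      if_neg (show j ≠ k by omega)] at h
    split_ifs at h ⊢ <;> linarith
  · intro i hki hin
    have key := linear_lower_bound_of_second_difference (fun j => y (n + 1 - j)) (n + 1 - k)
      (by simpa using hyn1) (fun j hj hjk => by
        have h := hfeas (n + 1 - j) (by omega) (by omega)
        rw [if_neg (show n + 1 - j ≠ k by omega), if_neg (show n + 1 - j ≠ k by omega),
          show n + 1 - j - 1 = n + 1 - (j + 1) by omega,
          show n + 1 - j + 1 = n + 1 - (j - 1) by omega] at h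
        by_cases hj1 : j = 1
        · rw [if_pos (show n + 1 - j = n by omega)] at h
          rw [if_pos hj1]
          split_ifs at h <;> linarith
        · rw [if_neg (show n + 1 - j ≠ n by omega)] at h
          rw [if_neg hj1]
          split_ifs at h <;> linarith) (n + 1 - i) (by omega) (by omega)
    rw [Nat.cast_sub (by omega), show n + 1 - (n + 1 - i) = i by omega,
      Nat.add_sub_cancel] at key
    push_cast at key
    linarith
  · have h := hfeas k hk1 hkn.le
    rw [if_pos rfl, if_pos rfl] at h
    split_ifs at h <;> linarith
end

section
/- Fix integers n ≥ 2 and k with 1 ≤ k and 2k ≤ n + 1. Suppose the real numbers y_1, …, y_n, z are dual-feasible, i.e. (with the conventions y_0 = 0 and y_{n+1} = 0): y_j ≥ 0 for all 1 ≤ j ≤ n, z ≥ 0, and for every j with 1 ≤ j ≤ n one has (1/2)y_{j−1} − y_j + (1/2)y_{j+1} + [j = k]·z ≥ [j = 1] − [j = k] + [j = n], where [P] denotes 1 if P holds and 0 otherwise. Then y_1 + y_2 + … + y_n + z ≥ n² − 2kn + 2n + 2k² − 6k + 4. -/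
/-- Discrete Green identity on `{1, …, m}` for the half second difference operator, tested against
the quadratic weight `(j - a) ^ 2`, whose half second difference is `1`. -/
theorem sum_sq_mul_half_second_difference (y : ℕ → ℝ) (a : ℝ) (m : ℕ) :
    ∑ j ∈ Finset.Icc 1 m,
        ((j : ℝ) - a) ^ 2 * ((1 / 2) * y (j - 1) - y j + (1 / 2) * y (j + 1)) =
      ∑ j ∈ Finset.Icc 1 m, y j
        + (((m : ℝ) - a) ^ 2 * y (m + 1) - ((m : ℝ) + 1 - a) ^ 2 * y m) / 2
        - (a ^ 2 * y 1 - (1 - a) ^ 2 * y 0) / 2 := by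
  induction m with
  | zero => simp
  | succ m ih =>
    rw [Finset.sum_Icc_succ_top (by omega), Finset.sum_Icc_succ_top (by omega), ih]
    simp only [Nat.add_sub_cancel]
    push_cast
    ring

/-- the lower-bound half of the Corollary in Section 7. Every dual-feasible
point `(y, z)` (with conventions `y 0 = 0`, `y (n+1) = 0`) has objective value
`y_1 + … + y_n + z` at least `n² − 2kn + 2n + 2k² − 6k + 4`. -/
theorem dual_objective_lower_bound (n k : ℕ) (hn : 2 ≤ n) (hk1 : 1 ≤ k)
    (hk2 : 2 * k ≤ n + 1)
    (y : ℕ → ℝ) (z : ℝ) (hy0 : y 0 = 0) (hyn1 : y (n + 1) = 0)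
    (hynn : ∀ j, 1 ≤ j → j ≤ n → 0 ≤ y j) (hz : 0 ≤ z)
    (hfeas : ∀ j, 1 ≤ j → j ≤ n →
      (if j = 1 then (1 : ℝ) else 0) - (if j = k then 1 else 0)
          + (if j = n then 1 else 0) ≤
        (1 / 2) * y (j - 1) - y j + (1 / 2) * y (j + 1) + (if j = k then z else 0)) :
    (n : ℝ) ^ 2 - 2 * k * n + 2 * n + 2 * k ^ 2 - 6 * k + 4 ≤
      (∑ i ∈ Finset.Icc 1 n, y i) + z := by
  have hsum := Finset.sum_le_sum fun j (hj : j ∈ Finset.Icc 1 n) =>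
    mul_le_mul_of_nonneg_left
      (hfeas j (Finset.mem_Icc.mp hj).1 (Finset.mem_Icc.mp hj).2)
      (sq_nonneg ((j : ℝ) - ((k : ℝ) - 1)))
  have h1 : 1 ∈ Finset.Icc 1 n := Finset.mem_Icc.mpr ⟨le_rfl, by omega⟩
  have hk : k ∈ Finset.Icc 1 n := Finset.mem_Icc.mpr ⟨hk1, by omega⟩
  have hn' : n ∈ Finset.Icc 1 n := Finset.mem_Icc.mpr ⟨by omega, le_rfl⟩
  simp only [mul_add _ _ (ite _ z 0), mul_add _ _ (ite _ (1 : ℝ) 0), mul_sub _ _ (ite _ (1 : ℝ) 0),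
    Finset.sum_add_distrib, Finset.sum_sub_distrib, mul_ite, mul_zero, mul_one,
    Finset.sum_ite_eq', h1, hk, hn', if_true, Nat.cast_one] at hsum
  rw [sum_sq_mul_half_second_difference, hy0, hyn1] at hsum
  have hy1 := mul_nonneg (sq_nonneg ((k : ℝ) - 1)) (hynn 1 le_rfl (by omega))
  have hyn := mul_nonneg (sq_nonneg ((n : ℝ) + 1 - ((k : ℝ) - 1))) (hynn n (by omega) le_rfl)
  have hkk : ((k : ℝ) - (k - 1)) ^ 2 = 1 := by ring
  rw [hkk] at hsum
  linarith
end

section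
/- Fix integers n ≥ 2 and k with 1 ≤ k and 2k ≤ n + 1. Call real numbers y_1, …, y_n, z dual-feasible if (with the conventions y_0 = 0 and y_{n+1} = 0): y_j ≥ 0 for all 1 ≤ j ≤ n, z ≥ 0, and for every j with 1 ≤ j ≤ n one has (1/2)y_{j−1} − y_j + (1/2)y_{j+1} + [j = k]·z ≥ [j = 1] − [j = k] + [j = n], where [P] denotes 1 if P holds and 0 otherwise. Then n² − 2kn + 2n + 2k² − 6k + 4 is the least element of the set {y_1 + … + y_n + z : (y_1, …, y_n, z) dual-feasible}; i.e., the minimum of the dual linear program equals n² − 2kn + 2n + 2k² − 6k + 4, attained at the point with y_i = 2(i−1) for 1 ≤ i ≤ k−1, y_i = 2(n−i) for k ≤ i ≤ n, and z = n − 2(k−1). -/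
/-- Dual feasibility for the linear program of the symmetric spherical skeleton of
`PSL(n+1) ⊆ PSL(n+1) × PSL(n+1)` with marked spherical root `γ_k`
(with the conventions `y 0 = 0` and `y (n+1) = 0`). -/
def DualFeasible (n k : ℕ) (y : ℕ → ℝ) (z : ℝ) : Prop :=
  y 0 = 0 ∧ y (n + 1) = 0 ∧ (∀ j, 1 ≤ j → j ≤ n → 0 ≤ y j) ∧ 0 ≤ z ∧
    ∀ j, 1 ≤ j → j ≤ n →
      (if j = 1 then (1 : ℝ) else 0) - (if j = k then 1 else 0)
          + (if j = n then 1 else 0) ≤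
        (1 / 2) * y (j - 1) - y j + (1 / 2) * y (j + 1) + (if j = k then z else 0)

/-- Green's identity for the discrete Laplacian on `{1, …, m}`, paired with `(j - c + 1)²`,
whose discrete Laplacian is constant. -/
lemma sum_sq_mul_laplacian (c : ℝ) (y : ℕ → ℝ) (m : ℕ) :
    ∑ j ∈ Finset.Icc 1 m, ((j : ℝ) - c + 1) ^ 2 *
        ((1 / 2) * y (j - 1) - y j + (1 / 2) * y (j + 1)) =
      ∑ j ∈ Finset.Icc 1 m, y j
        + (1 / 2) * (((m : ℝ) - c + 1) ^ 2 * y (m + 1) - ((m : ℝ) - c + 2) ^ 2 * y m)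
        - (1 / 2) * ((1 - c) ^ 2 * y 1 - (2 - c) ^ 2 * y 0) := by
  induction m with
  | zero => simp; ring
  | succ m ih =>
    rw [Finset.sum_Icc_succ_top (by omega), Finset.sum_Icc_succ_top (by omega), ih]
    simp only [Nat.add_sub_cancel]
    push_cast
    ring

/-- Weak duality: the primal solution `x j = (j - k + 1)²` bounds the dual objective below. -/
lemma DualFeasible.le_sum_add {n k : ℕ} {y : ℕ → ℝ} {z : ℝ} (hk1 : 1 ≤ k) (hkn : k ≤ n)
    (h : DualFeasible n k y z) :
    (n : ℝ) ^ 2 - 2 * k * n + 2 * n + 2 * k ^ 2 - 6 * k + 4 ≤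
      (∑ i ∈ Finset.Icc 1 n, y i) + z := by
  obtain ⟨h0, hn1, hy, -, hc⟩ := h
  have key : ∑ j ∈ Finset.Icc 1 n, ((j : ℝ) - k + 1) ^ 2 *
        ((if j = 1 then (1 : ℝ) else 0) - (if j = k then 1 else 0)
          + (if j = n then 1 else 0) - (if j = k then z else 0)) ≤
      ∑ j ∈ Finset.Icc 1 n, ((j : ℝ) - k + 1) ^ 2 *
        ((1 / 2) * y (j - 1) - y j + (1 / 2) * y (j + 1)) := by
    refine Finset.sum_le_sum fun j hj => mul_le_mul_of_nonneg_left ?_ (sq_nonneg _)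
    rw [Finset.mem_Icc] at hj
    linarith [hc j hj.1 hj.2]
  rw [sum_sq_mul_laplacian, h0, hn1] at key
  simp only [mul_sub, mul_add, Finset.sum_sub_distrib, Finset.sum_add_distrib, mul_ite, mul_one,
    mul_zero, Finset.sum_ite_eq', Finset.mem_Icc, le_refl, hk1, hkn, hk1.trans hkn, and_self,
    if_true, Nat.cast_one] at key
  have h1 := mul_nonneg (sq_nonneg (1 - (k : ℝ))) (hy 1 le_rfl (hk1.trans hkn))
  have h2 := mul_nonneg (sq_nonneg ((n : ℝ) - k + 2)) (hy n (hk1.trans hkn) le_rfl)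
  linarith

/-- The optimal vertex of the dual linear program. -/
noncomputable def dualOptimum (n k i : ℕ) : ℝ :=
  if i = 0 ∨ n < i then 0 else if i < k then 2 * ((i : ℝ) - 1) else 2 * ((n : ℝ) - i)

lemma sum_dualOptimum {n k : ℕ} (hk1 : 1 ≤ k) {m : ℕ} (hm : m ≤ n) :
    ∑ i ∈ Finset.Icc 1 m, dualOptimum n k i =
      if m < k then (m : ℝ) * (m - 1)
      else ((k : ℝ) - 1) * (k - 2) + ((m : ℝ) - k + 1) * (2 * n - k - m) := by
  induction m with
  | zero => simp [Nat.lt_of_succ_le hk1]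
  | succ m ih =>
    rw [Finset.sum_Icc_succ_top (by omega), ih (by omega), dualOptimum,
      if_neg (c := m + 1 = 0 ∨ n < m + 1) (by omega)]
    rcases lt_trichotomy (m + 1) k with h | rfl | h
    · rw [if_pos (show m < k by omega), if_pos h, if_pos h]
      push_cast
      ring
    · rw [if_pos (Nat.lt_succ_self m), if_neg (lt_irrefl _), if_neg (lt_irrefl _)]
      push_cast
      ring
    · rw [if_neg (show ¬ m < k by omega), if_neg h.not_gt, if_neg h.not_gt]
      push_cast
      ring

lemma dualFeasible_dualOptimum {n k : ℕ} (hn : 2 ≤ n) (hk1 : 1 ≤ k) (hk2 : 2 * k ≤ n + 1) :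
    DualFeasible n k (dualOptimum n k) ((n : ℝ) - 2 * ((k : ℝ) - 1)) := by
  have hk2R : 2 * (k : ℝ) ≤ n + 1 := by exact_mod_cast hk2
  refine ⟨by simp [dualOptimum], by simp [dualOptimum], fun j h1 h2 => ?_, by linarith,
    fun j h1 h2 => ?_⟩
  · have h1R : (1 : ℝ) ≤ j := by exact_mod_cast h1
    have h2R : (j : ℝ) ≤ n := by exact_mod_cast h2
    unfold dualOptimum
    split_ifs <;> linarith
  · obtain ⟨i, rfl⟩ : ∃ i, j = i + 1 := ⟨j - 1, by omega⟩
    simp only [dualOptimum, Nat.add_sub_cancel, Nat.succ_ne_zero, false_or]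
    by_cases hi : i = 0 <;> by_cases hk : i + 2 = k <;> by_cases hk' : i + 1 = k <;>
      by_cases hn' : i + 1 = n <;> first
        | omega
        | try subst hi
          try subst hk
          try subst hk'
          try subst hn'
          split_ifs <;> first
            | omega
            | push_cast at hk2R ⊢
              linarith

/-- the Corollary in Section 7. The minimum of the dual linear program equals
`n² − 2kn + 2n + 2k² − 6k + 4`, attained at `y_i = 2(i−1)` for `1 ≤ i ≤ k−1`,
`y_i = 2(n−i)` for `k ≤ i ≤ n`, and `z = n − 2(k−1)`. -/
theorem dual_lp_minimum (n k : ℕ) (hn : 2 ≤ n) (hk1 : 1 ≤ k) (hk2 : 2 * k ≤ n + 1) :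
    IsLeast {s : ℝ | ∃ y : ℕ → ℝ, ∃ z : ℝ, DualFeasible n k y z ∧
        s = (∑ i ∈ Finset.Icc 1 n, y i) + z}
      ((n : ℝ) ^ 2 - 2 * k * n + 2 * n + 2 * k ^ 2 - 6 * k + 4) ∧
    ∃ y : ℕ → ℝ, ∃ z : ℝ, DualFeasible n k y z ∧
      (∀ i, 1 ≤ i → i < k → y i = 2 * ((i : ℝ) - 1)) ∧
      (∀ i, k ≤ i → i ≤ n → y i = 2 * ((n : ℝ) - (i : ℝ))) ∧
      z = (n : ℝ) - 2 * ((k : ℝ) - 1) ∧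
      (∑ i ∈ Finset.Icc 1 n, y i) + z =
        (n : ℝ) ^ 2 - 2 * k * n + 2 * n + 2 * k ^ 2 - 6 * k + 4 := by
  have hsum : (∑ i ∈ Finset.Icc 1 n, dualOptimum n k i) + ((n : ℝ) - 2 * ((k : ℝ) - 1)) =
      (n : ℝ) ^ 2 - 2 * k * n + 2 * n + 2 * k ^ 2 - 6 * k + 4 := by
    rw [sum_dualOptimum hk1 le_rfl, if_neg (by omega)]
    ring
  have hfeas := dualFeasible_dualOptimum hn hk1 hk2
  refine ⟨⟨⟨_, _, hfeas, hsum.symm⟩, ?_⟩, _, _, hfeas, fun i h1 h2 => ?_, fun i h1 h2 => ?_, rfl,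
    hsum⟩
  · rintro _ ⟨y, z, h, rfl⟩
    exact h.le_sum_add hk1 (by omega)
  · rw [dualOptimum, if_neg (by omega), if_pos h2]
  · rw [dualOptimum, if_neg (by omega), if_neg (by omega)]
end

section
/- Fix integers n ≥ 2 and k with 1 ≤ k and 2k ≤ n + 1. Call real numbers x_1, …, x_n primal-feasible if (with the conventions x_0 = 0 and x_{n+1} = 0): x_j ≥ 0 for all 1 ≤ j ≤ n, (1/2)x_{j−1} − x_j + (1/2)x_{j+1} ≤ 1 for every 1 ≤ j ≤ n, and x_k ≤ 1. Then n² − 2kn + 2n + 2k² − 6k + 4 is the greatest element of the set {x_1 − x_k + x_n : (x_1, …, x_n) primal-feasible}; i.e., the maximum of x_1 − x_k + x_n over the primal-feasible region exists and equals n² − 2kn + 2n + 2k² − 6k + 4. -/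
/-- Primal feasibility for the linear program computing `ı(𝓡) − n` for the symmetric
spherical skeleton of `PSL(n+1) ⊆ PSL(n+1) × PSL(n+1)` with marked spherical root `γ_k`
(with the conventions `x 0 = 0` and `x (n+1) = 0`). -/
def PrimalFeasible (n k : ℕ) (x : ℕ → ℝ) : Prop :=
  x 0 = 0 ∧ x (n + 1) = 0 ∧ (∀ j, 1 ≤ j → j ≤ n → 0 ≤ x j) ∧
    (∀ j, 1 ≤ j → j ≤ n → (1 / 2) * x (j - 1) - x j + (1 / 2) * x (j + 1) ≤ 1) ∧
    x k ≤ 1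

/-- A sequence whose second differences are at most `2` on an initial segment is bounded there by
the quadratic with second difference `2` and the same first two values. -/
theorem le_quadratic_of_second_difference_le_two (a : ℕ → ℝ) (N : ℕ)
    (h : ∀ m, m + 2 ≤ N → a (m + 2) ≤ 2 + 2 * a (m + 1) - a m) :
    ∀ m, m ≤ N → a m ≤ a 0 + m * (a 1 - a 0) + m * (m - 1) := by
  have slope : ∀ m, m + 1 ≤ N → a (m + 1) - a m ≤ a 1 - a 0 + 2 * m := by
    intro m
    induction m with
    | zero => intro _; simp
    | succ m ih =>
      intro hm
      have h₁ := ih (by omega)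
      have h₂ := h m hm
      push_cast
      linarith
  intro m
  induction m with
  | zero => intro _; simp
  | succ m ih =>
    intro hm
    have h₁ := ih (by omega)
    have h₂ := slope m hm
    push_cast
    linarith

/-- the primal form of the linear-program value computed in Section 7.
The maximum of `x_1 − x_k + x_n` over the primal-feasible region exists and equals
`n² − 2kn + 2n + 2k² − 6k + 4`. -/
theorem primal_lp_maximum (n k : ℕ) (hn : 2 ≤ n) (hk1 : 1 ≤ k) (hk2 : 2 * k ≤ n + 1) :
    IsGreatest {s : ℝ | ∃ x : ℕ → ℝ, PrimalFeasible n k x ∧ s = x 1 - x k + x n}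
      ((n : ℝ) ^ 2 - 2 * k * n + 2 * n + 2 * k ^ 2 - 6 * k + 4) := by
  constructor
  · let q : ℕ → ℝ := fun j => ((j : ℝ) - k + 1) ^ 2
    let x : ℕ → ℝ := fun j => if 1 ≤ j ∧ j ≤ n then q j else 0
    have hx : ∀ j, 1 ≤ j → j ≤ n → x j = q j := fun j h₁ h₂ => if_pos ⟨h₁, h₂⟩
    have hle : ∀ j, x j ≤ q j := by
      intro j
      by_cases hj : 1 ≤ j ∧ j ≤ n
      · exact (hx j hj.1 hj.2).le
      · exact (if_neg hj).trans_le (sq_nonneg _)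
    refine ⟨x, ⟨by simp [x], by simp [x], ?_, ?_, ?_⟩, ?_⟩
    · intro j h₁ h₂
      rw [hx j h₁ h₂]
      exact sq_nonneg _
    · intro j h₁ h₂
      obtain ⟨i, rfl⟩ : ∃ i, j = i + 1 := ⟨j - 1, by omega⟩
      rw [hx _ h₁ h₂, Nat.add_sub_cancel]
      have h₃ := hle i
      have h₄ := hle (i + 1 + 1)
      simp only [q] at h₃ h₄ ⊢
      push_cast at h₄ ⊢
      linarith
    · rw [hx k hk1 (by omega)]
      simp [q]
    · rw [hx 1 le_rfl (by omega), hx k hk1 (by omega), hx n (by omega) le_rfl]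
      simp only [q]
      push_cast
      ring
  · rintro _ ⟨x, ⟨h0, -, hnonneg, hcolor, hxk⟩, rfl⟩
    obtain ⟨p, rfl⟩ : ∃ p, k = p + 1 := ⟨k - 1, by omega⟩
    obtain ⟨d, rfl⟩ : ∃ d, n = 2 * p + 1 + d := ⟨n - (2 * p + 1), by omega⟩
    have hp : 0 ≤ x p := by
      rcases Nat.eq_zero_or_pos p with rfl | hp
      · exact h0.ge
      · exact hnonneg p hp (by omega)
    have forward := le_quadratic_of_second_difference_le_two (fun m => x (p + m)) (p + 1 + d)
      (fun m hm => by
        have h := hcolor (p + m + 1) (by omega) (by omega)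
        rw [Nat.add_sub_cancel] at h
        simp only [← add_assoc]
        linarith) (p + 1 + d) le_rfl
    have backward := le_quadratic_of_second_difference_le_two (fun m => x (p + 1 - m)) p
      (fun m hm => by
        obtain ⟨i, rfl⟩ := Nat.exists_eq_add_of_le hm
        have h := hcolor (i + 2) (by omega) (by omega)
        have e₁ : m + 2 + i + 1 - (m + 2) = i + 1 := by omega
        have e₂ : m + 2 + i + 1 - (m + 1) = i + 2 := by omega
        have e₃ : m + 2 + i + 1 - m = i + 2 + 1 := by omega
        have e₄ : i + 2 - 1 = i + 1 := by omega
        rw [e₄] at h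
        simp only [e₁, e₂, e₃]
        linarith) p le_rfl
    have e : p + (p + 1 + d) = 2 * p + 1 + d := by ring
    simp only [e, Nat.add_sub_cancel_left, Nat.add_sub_cancel, Nat.sub_zero, add_zero]
      at forward backward
    have slope : (d : ℝ) * (x (p + 1) - x p) ≤ d * 1 :=
      mul_le_mul_of_nonneg_left (by linarith) d.cast_nonneg
    push_cast at forward ⊢
    nlinarith
end

section
/- Let n and k be natural numbers with 1 ≤ k < n, and let y : ℕ → ℝ be such that y_{n−1} ≥ 2 + 2·y_n and y_j ≥ 2·y_{j+1} − y_{j+2} for every j with k ≤ j ≤ n−2. Then for every i with k ≤ i ≤ n one has y_i ≥ 2·(n−i) + (n−i+1)·y_n. -/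
/-- The backward differences of a sequence that is convex on `[k, n]` are all at least the last
one. -/
theorem le_backward_difference {n k : ℕ} {y : ℕ → ℝ} {c : ℝ}
    (hlast : c ≤ y (n - 1) - y n)
    (hrec : ∀ j, k ≤ j → j + 2 ≤ n → 2 * y (j + 1) - y (j + 2) ≤ y j)
    {i : ℕ} (hki : k ≤ i) (hin : i < n) : c ≤ y i - y (i + 1) := by
  obtain ⟨m, rfl⟩ := Nat.exists_eq_add_of_lt hin
  induction m generalizing i with
  | zero => simpa using hlast
  | succ m ih =>
    have hnext : c ≤ y (i + 1) - y (i + 2) := by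
      have hn : i + (m + 1) + 1 = i + 1 + m + 1 := by omega
      rw [hn] at hlast hrec
      exact ih (hlast := hlast) (hrec := hrec) (hki := by omega) (hin := by omega)
    linarith [hrec i hki (by omega)]

/-- part (ii) of Proposition 7.1 in self-contained form. If `1 ≤ k < n`,
`y_{n−1} ≥ 2 + 2 y_n` and `y_j ≥ 2 y_{j+1} − y_{j+2}` for `k ≤ j ≤ n−2`, then
`y_i ≥ 2(n−i) + (n−i+1) y_n` for every `k ≤ i ≤ n`. -/
theorem backward_lower_bounds (n k : ℕ) (hk1 : 1 ≤ k) (hkn : k < n)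
    (y : ℕ → ℝ) (hinit : 2 + 2 * y n ≤ y (n - 1))
    (hrec : ∀ j, k ≤ j → j ≤ n - 2 → 2 * y (j + 1) - y (j + 2) ≤ y j) :
    ∀ i, k ≤ i → i ≤ n →
      2 * ((n : ℝ) - (i : ℝ)) + ((n : ℝ) - (i : ℝ) + 1) * y n ≤ y i := by
  intro i hki hin
  have hdiff {j : ℕ} (hkj : k ≤ j) (hjn : j < n) : 2 + y n ≤ y j - y (j + 1) :=
    le_backward_difference (by linarith) (fun l hkl hln => hrec l hkl (by omega)) hkj hjn
  induction hin using Nat.decreasingInduction with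
  | self => simp
  | of_succ j hjn ih =>
    have hnext := ih (by omega)
    push_cast at hnext
    linarith [hdiff hki hjn]
end
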